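/- Suppose u and y are three times differentiable on an open interval with u' > 0, y' > 0, u'' ≠ 0 everywhere, and suppose they satisfy the Bäcklund relation u - 2(u')²/u'' + α·(y''/(y')^{3/2}) = 0 for a nonzero constant α. If u satisfies the Schwarz equation u'''u' = (3/2)(u'')², then y satisfies the Schwarz equation y'''y' = (3/2)(y'')² at every point where y'' ≠ 0 or by continuity. -/

import Mathlib

lemma bt_aux (a b : ℝ) (f : ℝ → ℝ) (hf : ContDiffOn ℝ 3 f (Set.Ioo a b)) (x : ℝ)
    (hx : x ∈ Set.Ioo a b) :
    HasDerivAt f (deriv f x) x ∧ HasDerivAt (deriv f) (deriv (deriv f) x) x ∧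
      HasDerivAt (deriv (deriv f)) (deriv (deriv (deriv f)) x) x := by
  have h1 : ContDiffOn ℝ 2 (deriv f) (Set.Ioo a b) :=
    hf.deriv_of_isOpen isOpen_Ioo (by norm_num)
  have h2 : ContDiffOn ℝ 1 (deriv (deriv f)) (Set.Ioo a b) :=
    h1.deriv_of_isOpen isOpen_Ioo (by norm_num)
  have hn := isOpen_Ioo.mem_nhds hx
  exact ⟨((hf.differentiableOn (by norm_num)).differentiableAt hn).hasDerivAt,
    ((h1.differentiableOn (by norm_num)).differentiableAt hn).hasDerivAt,
    ((h2.differentiableOn (by norm_num)).differentiableAt hn).hasDerivAt⟩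

/-- An auto-Bäcklund transformation for the Schwarz equation: if `u`, `y` are three times
differentiable on an open interval with `u' > 0`, `y' > 0`, `u'' ≠ 0`, and satisfy the relation
`u - 2(u')²/u'' + α (y''/(y')^{3/2}) = 0` for a nonzero constant `α`, then whenever `u`
satisfies the Schwarz equation on the interval, so does `y`. -/
theorem backlund_transfers_schwarz (a b α : ℝ) (hα : α ≠ 0) (u y : ℝ → ℝ)
    (hu : ContDiffOn ℝ 3 u (Set.Ioo a b))
    (hy : ContDiffOn ℝ 3 y (Set.Ioo a b))
    (hu' : ∀ x ∈ Set.Ioo a b, 0 < deriv u x)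
    (hy' : ∀ x ∈ Set.Ioo a b, 0 < deriv y x)
    (hu'' : ∀ x ∈ Set.Ioo a b, deriv (deriv u) x ≠ 0)
    (hrel : ∀ x ∈ Set.Ioo a b,
      u x - 2 * (deriv u x) ^ 2 / deriv (deriv u) x
        + α * (deriv (deriv y) x / (deriv y x) ^ ((3 : ℝ) / 2)) = 0)
    (hschwarz : ∀ x ∈ Set.Ioo a b,
      deriv (deriv (deriv u)) x * deriv u x = (3 / 2) * (deriv (deriv u) x) ^ 2) :
    ∀ x ∈ Set.Ioo a b,
      deriv (deriv (deriv y)) x * deriv y x = (3 / 2) * (deriv (deriv y) x) ^ 2 := by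
  intro x hx
  obtain ⟨hu1, hu2, hu3⟩ := bt_aux a b u hu x hx
  obtain ⟨hy1, hy2, hy3⟩ := bt_aux a b y hy x hx
  have hp := hy' x hx
  have hq := hu'' x hx
  have hS := hschwarz x hx
  have hP : 0 < (deriv y x) ^ ((3 : ℝ) / 2) := Real.rpow_pos_of_pos hp _
  have hD := (hu1.sub (((hu2.pow 2).const_mul 2).div hu3 hq)).add
    ((hy3.div (hy2.rpow_const (p := (3 : ℝ) / 2) (Or.inl hp.ne')) hP.ne').const_mul α)
  have hZ := (hasDerivAt_const x (0 : ℝ)).congr_of_eventuallyEq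
    (Filter.eventually_of_mem (isOpen_Ioo.mem_nhds hx) hrel)
  have hE := hD.unique hZ
  have hr : (deriv y x) ^ ((3 : ℝ) / 2) = deriv y x * (deriv y x) ^ ((3 : ℝ) / 2 - 1) := by
    rw [Real.rpow_sub_one hp.ne']; field_simp
  have hR : 0 < (deriv y x) ^ ((3 : ℝ) / 2 - 1) := Real.rpow_pos_of_pos hp _
  simp only [Pi.pow_apply] at hE
  clear hD hZ hu1 hu2 hu3 hy1 hy2 hy3
  rw [hr] at hE
  generalize (deriv y x) ^ ((3 : ℝ) / 2 - 1) = r at *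
  generalize deriv (deriv (deriv y)) x = y3 at *
  generalize deriv (deriv (deriv u)) x = u3 at *
  generalize deriv (deriv y) x = y2 at *
  generalize deriv (deriv u) x = u2 at *
  generalize deriv y x = p at *
  generalize deriv u x = v at *
  have h0 : v - (2 * (2 * v * u2) * u2 - 2 * v ^ 2 * u3) / u2 ^ 2 = 0 := by
    field_simp
    linear_combination 2 * v * hS
  have h1 : α * ((y3 * (p * r) - y2 * (y2 * (3 / 2) * r)) / (p * r) ^ 2) = 0 := by
    norm_num at hE
    linear_combination hE - h0
  have h2 : y3 * (p * r) - y2 * (y2 * (3 / 2) * r) = 0 := by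
    rcases mul_eq_zero.1 h1 with h | h
    · exact absurd h hα
    · rcases div_eq_zero_iff.1 h with h | h
      · exact h
      · exact absurd h (by positivity)
  apply mul_right_cancel₀ hR.ne'
  linear_combination h2
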